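/- arXiv:2204.00066 — 2 statements merged into one kernel-verified Lean document; each statement's English description precedes it below -/
import Mathlib

section
/- Let λ be a partition of n ≥ 2 with removable cells (i₁,i'₁),…,(i_s,i'_s). Then R_λ(x) = Σ_{j=1}^{s} x^{λ'_{i'_j+1}} (1 + x + … + x^{α_{i'_j−1}}) · R_{λ↓_j}(x), with the conventions λ'_{N'+1} = 0 and α₀ = 0 (so the parenthesized sum equals 1 when i'_j = 1). -/
open Polynomial

/-- `f` represents the partition `λ₁ ≥ λ₂ ≥ … ≥ λ_N > 0` of `n`:
`f i = λᵢ` for `1 ≤ i ≤ N` and `f i = 0` for `i > N`. -/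
def IsPartitionFun (f : ℕ → ℕ) (n N : ℕ) : Prop :=
  (∀ i j, i ≤ j → f j ≤ f i) ∧ (∀ i, 1 ≤ i → (0 < f i ↔ i ≤ N)) ∧
    ∑ i ∈ Finset.Icc 1 N, f i = n

/-- `A` is strictly upper triangular: `A i j = 0` whenever `j ≤ i`. -/
def StrictUpper {m : ℕ} {F : Type*} [Zero F] (A : Matrix (Fin m) (Fin m) F) : Prop :=
  ∀ i j : Fin m, (j : ℕ) ≤ (i : ℕ) → A i j = 0

/-- `A` has Jordan type `λ`: `rank (A ^ k) = Σᵢ max (λᵢ - k) 0` for every `k ≥ 0`. -/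
def HasJordanType {m : ℕ} {F : Type*} [Field F] (A : Matrix (Fin m) (Fin m) F)
    (f : ℕ → ℕ) (N : ℕ) : Prop :=
  ∀ k : ℕ, (A ^ k).rank = ∑ i ∈ Finset.Icc 1 N, (f i - k)

/-- The number of strictly upper triangular `m × m` matrices over `F` of Jordan type `λ`. -/
noncomputable def jordanCount (m : ℕ) (f : ℕ → ℕ) (N : ℕ)
    (F : Type) [Field F] [Fintype F] : ℕ :=
  Nat.card {A : Matrix (Fin m) (Fin m) F // StrictUpper A ∧ HasJordanType A f N}

/-- `dualPart f N j = λ'_j`, the number of parts of `λ` that are `≥ j`. -/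
def dualPart (f : ℕ → ℕ) (N j : ℕ) : ℕ :=
  ((Finset.Icc 1 N).filter fun i => j ≤ f i).card

/-- `alphaCount f N k = α_k`, the number of parts of `λ` equal to `k`. -/
def alphaCount (f : ℕ → ℕ) (N k : ℕ) : ℕ :=
  ((Finset.Icc 1 N).filter fun i => f i = k).card

/-- The rows containing a removable cell of the Young diagram of `λ`:
rows `1 ≤ i ≤ N` with `i = N` or `λ_{i+1} < λᵢ` (for `i = N` the condition
`f (i+1) < f i` holds automatically since `f (N+1) = 0 < f N`). -/
def removables (f : ℕ → ℕ) (N : ℕ) : Finset ℕ :=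
  (Finset.Icc 1 N).filter fun i => f (i + 1) < f i

section Bordering

variable {m : ℕ} {F : Type*}

/-- The block matrix `[[B, v], [0, 0]]`. -/
def borderMatrix [Zero F] (B : Matrix (Fin m) (Fin m) F) (v : Fin m → F) :
    Matrix (Fin (m + 1)) (Fin (m + 1)) F :=
  Matrix.of fun i j => Fin.lastCases 0 (fun i' => Fin.lastCases (v i') (B i') j) i

@[simp] lemma borderMatrix_castSucc_castSucc [Zero F] (B : Matrix (Fin m) (Fin m) F)
    (v : Fin m → F) (i j : Fin m) : borderMatrix B v i.castSucc j.castSucc = B i j := by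
  simp [borderMatrix]

@[simp] lemma borderMatrix_castSucc_last [Zero F] (B : Matrix (Fin m) (Fin m) F)
    (v : Fin m → F) (i : Fin m) : borderMatrix B v i.castSucc (Fin.last m) = v i := by
  simp [borderMatrix]

@[simp] lemma borderMatrix_last [Zero F] (B : Matrix (Fin m) (Fin m) F)
    (v : Fin m → F) (j : Fin (m + 1)) : borderMatrix B v (Fin.last m) j = 0 := by
  simp [borderMatrix]

/-- A strictly upper triangular matrix is a strictly upper triangular matrix of size one less
together with its last column. -/
def strictUpperEquiv [Zero F] :
    {A : Matrix (Fin (m + 1)) (Fin (m + 1)) F // StrictUpper A} ≃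
      {B : Matrix (Fin m) (Fin m) F // StrictUpper B} × (Fin m → F) where
  toFun A := (⟨fun i j => A.1 i.castSucc j.castSucc, fun i j h => A.2 _ _ (by simpa using h)⟩,
    fun i => A.1 i.castSucc (Fin.last m))
  invFun p := ⟨borderMatrix p.1.1 p.2, fun i j h => by
    induction i using Fin.lastCases with
    | last => simp
    | cast i =>
      induction j using Fin.lastCases with
      | last =>
        have := i.2
        simp only [Fin.val_last, Fin.val_castSucc] at h
        omega
      | cast j => simpa using p.1.2 i j (by simpa using h)⟩
  left_inv A := by
    ext i j
    induction i using Fin.lastCases with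
    | last => exact (borderMatrix_last _ _ _).trans (A.2 (Fin.last m) j j.is_le).symm
    | cast i =>
      induction j using Fin.lastCases with
      | last => exact borderMatrix_castSucc_last _ _ _
      | cast j => exact borderMatrix_castSucc_castSucc _ _ _ _
  right_inv p := by
    ext <;> simp

lemma borderMatrix_mul [Semiring F] (B C : Matrix (Fin m) (Fin m) F) (v w : Fin m → F) :
    borderMatrix B v * borderMatrix C w = borderMatrix (B * C) (B.mulVec w) := by
  ext i j
  induction i using Fin.lastCases with
  | last => simp [Matrix.mul_apply]
  | cast i =>
    induction j using Fin.lastCases <;>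
      simp [Matrix.mul_apply, Fin.sum_univ_castSucc, Matrix.mulVec, dotProduct]

lemma borderMatrix_pow_succ [Semiring F] (B : Matrix (Fin m) (Fin m) F) (v : Fin m → F) (k : ℕ) :
    borderMatrix B v ^ (k + 1) = borderMatrix (B ^ (k + 1)) ((B ^ k).mulVec v) := by
  induction k with
  | zero => simp
  | succ k ih => rw [pow_succ' _ (k + 1), ih, borderMatrix_mul, Matrix.mulVec_mulVec, ← pow_succ',
      ← pow_succ']

variable [Field F]

open Classical in
lemma rank_borderMatrix (C : Matrix (Fin m) (Fin m) F) (w : Fin m → F) :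
    (borderMatrix C w).rank = C.rank + if w ∈ C.mulVecLin.range then 0 else 1 := by
  let ι : (Fin m → F) →ₗ[F] (Fin (m + 1) → F) :=
    LinearMap.pi (Fin.lastCases 0 fun i => LinearMap.proj i)
  have hι : Function.Injective ι := fun x y h => by
    ext i
    simpa [ι] using congrFun h i.castSucc
  have hcol : (borderMatrix C w).col = Fin.snoc (fun j => ι (C.col j)) (ι w) := by
    ext j i
    induction i using Fin.lastCases <;> induction j using Fin.lastCases <;>
      simp [ι, Matrix.col]
  have hspan : Submodule.span F (Set.range (borderMatrix C w).col) =
      (C.mulVecLin.range ⊔ F ∙ w).map ι := by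
    rw [hcol, Fin.range_snoc, Submodule.span_insert, Submodule.map_sup, Submodule.map_span,
      Matrix.range_mulVecLin, Submodule.map_span, sup_comm, ← Set.range_comp]
    simp [Function.comp_def]
  rw [Matrix.rank_eq_finrank_span_cols, hspan, ← (Submodule.equivMapOfInjective ι hι _).finrank_eq,
    Matrix.rank]
  split_ifs with h
  · rw [sup_eq_left.2 ((Submodule.span_singleton_le_iff_mem _ _).2 h), add_zero]
  · exact Submodule.finrank_sup_span_singleton h

/-- The vectors `v` such that bordering `B` by `v` does not change the rank of the
`(k + 1)`-st power. -/
def neutralVectors (B : Matrix (Fin m) (Fin m) F) (k : ℕ) : Submodule F (Fin m → F) :=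
  (B ^ (k + 1)).mulVecLin.range.comap (B ^ k).mulVecLin

open Classical in
lemma rank_borderMatrix_pow_succ (B : Matrix (Fin m) (Fin m) F) (v : Fin m → F) (k : ℕ) :
    (borderMatrix B v ^ (k + 1)).rank =
      (B ^ (k + 1)).rank + if v ∈ neutralVectors B k then 0 else 1 := by
  rw [borderMatrix_pow_succ, rank_borderMatrix]
  rfl

lemma neutralVectors_mono (B : Matrix (Fin m) (Fin m) F) : Monotone (neutralVectors B) := by
  refine monotone_nat_of_le_succ fun k v => ?_
  rintro ⟨x, hx⟩
  refine ⟨x, ?_⟩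
  simp only [Matrix.mulVecLin_apply] at hx ⊢
  rw [pow_succ' B (k + 1), ← Matrix.mulVec_mulVec, hx, Matrix.mulVec_mulVec, ← pow_succ']

lemma finrank_comap_add_finrank_range {K V W : Type*} [Field K] [AddCommGroup V] [Module K V]
    [AddCommGroup W] [Module K W] [FiniteDimensional K V] (L : V →ₗ[K] W) (S : Submodule K W)
    (hS : S ≤ L.range) :
    Module.finrank K (S.comap L) + Module.finrank K L.range =
      Module.finrank K S + Module.finrank K V := by
  have h1 := (L.domRestrict (S.comap L)).finrank_range_add_finrank_ker
  have h2 := L.finrank_range_add_finrank_ker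
  rw [LinearMap.range_domRestrict, Submodule.map_comap_eq_of_le hS, LinearMap.ker_domRestrict,
    (Submodule.comapSubtypeEquivOfLe (LinearMap.ker_le_comap L)).finrank_eq] at h1
  omega

lemma finrank_neutralVectors (B : Matrix (Fin m) (Fin m) F) (k : ℕ) :
    Module.finrank F (neutralVectors B k) + (B ^ k).rank = (B ^ (k + 1)).rank + m := by
  have := finrank_comap_add_finrank_range (B ^ k).mulVecLin (B ^ (k + 1)).mulVecLin.range (by
    rintro _ ⟨x, rfl⟩
    exact ⟨B.mulVec x, by simp [pow_succ]⟩)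
  rwa [Module.finrank_fin_fun] at this

end Bordering
section Partitions

/-- The row lengths after removing a cell from row `i`. -/
abbrev removeCell (f : ℕ → ℕ) (i : ℕ) : ℕ → ℕ := Function.update f i (f i - 1)

/-- The number of parts after removing a cell from row `i`. -/
abbrev removeLength (f : ℕ → ℕ) (N i : ℕ) : ℕ := if f i = 1 then N - 1 else N

/-- The rank prescribed by `f` for the `k`-th power. -/
def tailSum (f : ℕ → ℕ) (N k : ℕ) : ℕ := ∑ i ∈ Finset.Icc 1 N, (f i - k)

lemma tailSum_eq_succ_add_dualPart (f : ℕ → ℕ) (N k : ℕ) :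
    tailSum f N k = tailSum f N (k + 1) + dualPart f N (k + 1) := by
  rw [tailSum, tailSum, dualPart, Finset.card_filter, ← Finset.sum_add_distrib]
  refine Finset.sum_congr rfl fun i _ => ?_
  split_ifs <;> omega

lemma alphaCount_add_dualPart_succ (f : ℕ → ℕ) (N k : ℕ) :
    alphaCount f N k + dualPart f N (k + 1) = dualPart f N k := by
  rw [alphaCount, dualPart, dualPart, Finset.card_filter, Finset.card_filter, Finset.card_filter,
    ← Finset.sum_add_distrib]
  refine Finset.sum_congr rfl fun i _ => ?_
  split_ifs <;> omega

variable {f : ℕ → ℕ} {n N i : ℕ}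

lemma IsPartitionFun.dualPart_one (hf : IsPartitionFun f n N) : dualPart f N 1 = N := by
  rw [dualPart, Finset.filter_true_of_mem, Nat.card_Icc, Nat.add_sub_cancel]
  intro i hi
  rw [Finset.mem_Icc] at hi
  exact (hf.2.1 i hi.1).2 hi.2

lemma IsPartitionFun.alphaCount_zero (hf : IsPartitionFun f n N) : alphaCount f N 0 = 0 := by
  rw [alphaCount, Finset.card_eq_zero, Finset.filter_eq_empty_iff]
  intro i hi
  rw [Finset.mem_Icc] at hi
  exact ((hf.2.1 i hi.1).2 hi.2).ne'

lemma IsPartitionFun.apply_le (hf : IsPartitionFun f n N) {a : ℕ} (ha : a ∈ Finset.Icc 1 N) :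
    f a ≤ n :=
  hf.2.2 ▸ Finset.single_le_sum (fun _ _ => Nat.zero_le _) ha

lemma IsPartitionFun.dualPart_eq_zero (hf : IsPartitionFun f n N) {k : ℕ} (hk : n < k) :
    dualPart f N k = 0 := by
  rw [dualPart, Finset.card_eq_zero, Finset.filter_eq_empty_iff]
  intro i hi
  have := hf.apply_le hi
  omega

lemma IsPartitionFun.tailSum_zero (hf : IsPartitionFun f n N) : tailSum f N 0 = n := by
  simpa [tailSum] using hf.2.2

lemma IsPartitionFun.length_eq_zero (hf : IsPartitionFun f 0 N) : N = 0 := by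
  by_contra hN
  have hmem : N ∈ Finset.Icc 1 N := Finset.mem_Icc.2 ⟨Nat.pos_of_ne_zero hN, le_rfl⟩
  have := (hf.2.1 N (Nat.pos_of_ne_zero hN)).2 le_rfl
  have := hf.apply_le hmem
  omega

lemma mem_removables : i ∈ removables f N ↔ (1 ≤ i ∧ i ≤ N) ∧ f (i + 1) < f i := by
  rw [removables, Finset.mem_filter, Finset.mem_Icc]

lemma IsPartitionFun.eq_length (hf : IsPartitionFun f n N) (hi : i ∈ removables f N)
    (h1 : f i = 1) : i = N := by
  obtain ⟨⟨hi1, hiN⟩, hlt⟩ := mem_removables.1 hi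
  have := hf.2.1 (i + 1) (by omega)
  omega

lemma IsPartitionFun.sum_removeCell (hf : IsPartitionFun f n N) (hi : i ∈ removables f N)
    (φ : ℕ → ℕ) (hφ : φ 0 = 0) :
    ∑ a ∈ Finset.Icc 1 N, φ (f a) + φ (f i - 1) =
      ∑ a ∈ Finset.Icc 1 (removeLength f N i), φ (removeCell f i a) + φ (f i) := by
  obtain ⟨⟨hi1, hiN⟩, hlt⟩ := mem_removables.1 hi
  have hmem : i ∈ Finset.Icc 1 N := Finset.mem_Icc.2 ⟨hi1, hiN⟩
  have hlen : ∑ a ∈ Finset.Icc 1 (removeLength f N i), φ (removeCell f i a) =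
      ∑ a ∈ Finset.Icc 1 N, φ (removeCell f i a) := by
    unfold removeLength
    split_ifs with h1
    · have := hf.eq_length hi h1
      subst this
      obtain ⟨k, rfl⟩ : ∃ k, i = k + 1 := ⟨i - 1, by omega⟩
      rw [Finset.sum_Icc_succ_top (by omega)]
      simp [h1, hφ]
    · rfl
  rw [hlen, ← Finset.add_sum_erase _ _ hmem, ← Finset.add_sum_erase _ (fun a => φ (removeCell f i a))
    hmem]
  have : ∑ a ∈ (Finset.Icc 1 N).erase i, φ (removeCell f i a) =
      ∑ a ∈ (Finset.Icc 1 N).erase i, φ (f a) :=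
    Finset.sum_congr rfl fun a ha => by
      rw [removeCell, Function.update_of_ne (Finset.ne_of_mem_erase ha)]
  rw [this, removeCell, Function.update_self]
  ring

lemma IsPartitionFun.tailSum_removeCell (hf : IsPartitionFun f n N) (hi : i ∈ removables f N)
    (k : ℕ) : tailSum f N k =
      tailSum (removeCell f i) (removeLength f N i) k + if k < f i then 1 else 0 := by
  have := hf.sum_removeCell hi (· - k) (Nat.zero_sub k)
  rw [tailSum, tailSum]
  split_ifs <;> omega

lemma IsPartitionFun.dualPart_removeCell (hf : IsPartitionFun f n N) (hi : i ∈ removables f N)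
    {k : ℕ} (hk : 1 ≤ k) : dualPart f N k =
      dualPart (removeCell f i) (removeLength f N i) k + if k = f i then 1 else 0 := by
  have := hf.sum_removeCell hi (fun x => if k ≤ x then 1 else 0) (by simp; omega)
  have := (mem_removables.1 hi).2
  rw [dualPart, dualPart, Finset.card_filter, Finset.card_filter]
  split_ifs at * <;> omega

lemma IsPartitionFun.removeCell (hf : IsPartitionFun f n N) (hi : i ∈ removables f N) :
    IsPartitionFun (removeCell f i) (n - 1) (removeLength f N i) := by
  obtain ⟨⟨hi1, hiN⟩, hlt⟩ := mem_removables.1 hi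
  refine ⟨fun a b hab => ?_, fun a ha => ?_, ?_⟩
  · have h1 := hf.1 a b hab
    simp only [_root_.removeCell, Function.update_apply]
    split_ifs with hb ha ha
    · rfl
    · subst hb; omega
    · subst ha
      have := hf.1 (a + 1) b (by omega)
      omega
    · exact h1
  · have h1 := hf.2.1 a ha
    have h2 := hf.eq_length hi
    simp only [_root_.removeCell, removeLength, Function.update_apply]
    split_ifs with h3 h4 h4
    · omega
    · subst h3; omega
    · have := h2 h4
      omega
    · exact h1
  · have := hf.sum_removeCell hi id rfl
    have h2 := hf.2.2
    simp only [id] at this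
    omega

lemma IsPartitionFun.injOn_removables (hf : IsPartitionFun f n N) :
    Set.InjOn f (removables f N) := by
  have key : ∀ a b, a ∈ removables f N → a < b → f b < f a := fun a b ha hab =>
    (hf.1 (a + 1) b hab).trans_lt (mem_removables.1 ha).2
  intro a ha b hb hab
  rcases lt_trichotomy a b with h | h | h
  · exact absurd hab (key a b ha h).ne'
  · exact h
  · exact absurd hab (key b a hb h).ne

/-- If more parts are `≥ k` than are `≥ k + 1`, then the last part `≥ k` ends in a removable
cell in column `k`. -/
lemma IsPartitionFun.exists_mem_removables (hf : IsPartitionFun f n N) {k : ℕ}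
    (hk : dualPart f N (k + 2) < dualPart f N (k + 1)) : ∃ i ∈ removables f N, f i = k + 1 := by
  have hα : 0 < alphaCount f N (k + 1) := by
    have : _ + dualPart f N (k + 2) = _ := alphaCount_add_dualPart_succ f N (k + 1)
    omega
  obtain ⟨a, ha⟩ := Finset.card_pos.1 hα
  let s := (Finset.Icc 1 N).filter fun i => f i = k + 1
  have hs : s.Nonempty := ⟨a, ha⟩
  have hmax := s.max'_mem hs
  obtain ⟨hmem, hval⟩ := Finset.mem_filter.1 hmax
  have hmem' := Finset.mem_Icc.1 hmem
  refine ⟨s.max' hs, mem_removables.2 ⟨hmem', ?_⟩, hval⟩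
  have hle := hf.1 _ _ (Nat.le_add_right (s.max' hs) 1)
  refine lt_of_le_of_ne hle fun heq => ?_
  have hpos := (hf.2.1 (s.max' hs + 1) (by omega)).1 (by omega)
  have := s.le_max' (s.max' hs + 1) (Finset.mem_filter.2 ⟨Finset.mem_Icc.2 ⟨by omega, hpos⟩,
    heq.trans hval⟩)
  omega

end Partitions
section Counting

variable {f : ℕ → ℕ} {m n N i : ℕ} {F : Type*} [Field F]

open Classical in
lemma hasJordanType_borderMatrix_iff (hf : IsPartitionFun f (m + 1) N)
    (B : Matrix (Fin m) (Fin m) F) (v : Fin m → F) :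
    HasJordanType (borderMatrix B v) f N ↔ ∀ k, (B ^ (k + 1)).rank +
      (if v ∈ neutralVectors B k then 0 else 1) = tailSum f N (k + 1) := by
  refine ⟨fun h k => (rank_borderMatrix_pow_succ B v k).symm.trans (h (k + 1)), fun h k => ?_⟩
  cases k with
  | zero => exact (by simp : (borderMatrix B v ^ 0).rank = m + 1).trans hf.tailSum_zero.symm
  | succ k => exact (rank_borderMatrix_pow_succ B v k).trans (h k)

lemma hasJordanType_removeCell_iff (hf : IsPartitionFun f n N) (hi : i ∈ removables f N)
    (B : Matrix (Fin m) (Fin m) F) :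
    HasJordanType B (removeCell f i) (removeLength f N i) ↔
      ∀ k, (B ^ k).rank + (if k < f i then 1 else 0) = tailSum f N k := by
  refine forall_congr' fun k => ?_
  rw [hf.tailSum_removeCell hi k]
  exact (Nat.add_right_cancel_iff).symm

lemma exists_hasJordanType_removeCell (hf : IsPartitionFun f (m + 1) N)
    (B : Matrix (Fin m) (Fin m) F) (v : Fin m → F) (h : HasJordanType (borderMatrix B v) f N) :
    ∃ i ∈ removables f N, HasJordanType B (removeCell f i) (removeLength f N i) := by
  classical
  rw [hasJordanType_borderMatrix_iff hf] at h
  have hex : ∃ k, v ∈ neutralVectors B k := by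
    refine ⟨m, ?_⟩
    have h0 : tailSum f N (m + 1) = 0 :=
      Finset.sum_eq_zero fun a ha => Nat.sub_eq_zero_of_le (hf.apply_le ha)
    have := h m
    by_contra hv
    rw [if_neg hv] at this
    omega
  obtain ⟨k, hk⟩ : ∃ k, ∀ j, v ∈ neutralVectors B j ↔ k ≤ j :=
    ⟨Nat.find hex, fun j => ⟨fun hj => Nat.find_min' hex hj,
      fun hj => neutralVectors_mono B hj (Nat.find_spec hex)⟩⟩
  have hrank : ∀ j, (B ^ j).rank + (if j < k + 1 then 1 else 0) = tailSum f N j := by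
    intro j
    cases j with
    | zero => simpa using hf.tailSum_zero.symm
    | succ j =>
      rw [← h j]
      have := hk j
      split_ifs <;> first | rfl | (exfalso; grind)
  have hcol : dualPart f N (k + 2) < dualPart f N (k + 1) := by
    have e0 := hrank k
    have e1 := hrank (k + 1)
    have e2 := hrank (k + 2)
    rw [if_pos (by omega)] at e0
    rw [if_neg (by omega)] at e1 e2
    have t0 := tailSum_eq_succ_add_dualPart f N k
    have t1 : _ = tailSum f N (k + 2) + dualPart f N (k + 2) :=
      tailSum_eq_succ_add_dualPart f N (k + 1)
    have u0 := finrank_neutralVectors B k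
    have u1 : _ = (B ^ (k + 2)).rank + m := finrank_neutralVectors B (k + 1)
    have := Submodule.finrank_mono (neutralVectors_mono B (Nat.le_add_right k 1))
    omega
  obtain ⟨i, hi, hik⟩ := hf.exists_mem_removables hcol
  exact ⟨i, hi, (hasJordanType_removeCell_iff hf hi B).2 (by rwa [hik])⟩

lemma eq_of_hasJordanType_removeCell (hf : IsPartitionFun f n N) {j : ℕ}
    (hi : i ∈ removables f N) (hj : j ∈ removables f N) (B : Matrix (Fin m) (Fin m) F)
    (hBi : HasJordanType B (removeCell f i) (removeLength f N i))
    (hBj : HasJordanType B (removeCell f j) (removeLength f N j)) : i = j := by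
  rw [hasJordanType_removeCell_iff hf hi] at hBi
  rw [hasJordanType_removeCell_iff hf hj] at hBj
  refine hf.injOn_removables hi hj ?_
  have h1 := (hBi (f i)).trans (hBj (f i)).symm
  have h2 := (hBi (f j)).trans (hBj (f j)).symm
  split_ifs at h1 h2 <;> omega

lemma hasJordanType_borderMatrix_iff_mem (hf : IsPartitionFun f (m + 1) N)
    (hi : i ∈ removables f N) {k : ℕ} (hk : f i = k + 1) (B : Matrix (Fin m) (Fin m) F)
    (hB : HasJordanType B (removeCell f i) (removeLength f N i)) (v : Fin m → F) :
    HasJordanType (borderMatrix B v) f N ↔ ∀ j, v ∈ neutralVectors B j ↔ k ≤ j := by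
  classical
  rw [hasJordanType_borderMatrix_iff hf]
  rw [hasJordanType_removeCell_iff hf hi, hk] at hB
  refine forall_congr' fun j => ?_
  rw [← hB (j + 1), Nat.add_left_cancel_iff]
  split_ifs <;> grind

lemma finrank_neutralVectors_add_dualPart (hf : IsPartitionFun f (m + 1) N)
    (hi : i ∈ removables f N) (B : Matrix (Fin m) (Fin m) F)
    (hB : HasJordanType B (removeCell f i) (removeLength f N i)) (k : ℕ) :
    Module.finrank F (neutralVectors B k) + dualPart f N (k + 1) =
      m + if f i = k + 1 then 1 else 0 := by
  have := finrank_neutralVectors B k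
  have h0 := hB k
  have h1 := hB (k + 1)
  change _ = tailSum (removeCell f i) (removeLength f N i) _ at h0 h1
  have h2 := tailSum_eq_succ_add_dualPart (removeCell f i) (removeLength f N i) k
  have h3 := hf.dualPart_removeCell hi (Nat.le_add_left 1 k)
  split_ifs at h3 ⊢ <;> omega

variable [Fintype F]

lemma card_fiber_of_eq_one (hf : IsPartitionFun f (m + 1) N)
    (hi : i ∈ removables f N) (h1 : f i = 1) (B : Matrix (Fin m) (Fin m) F)
    (hB : HasJordanType B (removeCell f i) (removeLength f N i)) :
    Fintype.card F ^ (N - 1) * Nat.card {v // HasJordanType (borderMatrix B v) f N} =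
      Fintype.card F ^ m := by
  have hset : Nat.card {v // HasJordanType (borderMatrix B v) f N} =
      Nat.card (neutralVectors B 0) :=
    Nat.card_congr <| Equiv.subtypeEquivRight fun v => by
      rw [hasJordanType_borderMatrix_iff_mem hf hi (k := 0) h1 B hB]
      exact ⟨fun h => (h 0).2 le_rfl, fun h j =>
        iff_of_true (neutralVectors_mono B (Nat.zero_le j) h) (Nat.zero_le j)⟩
  have hdim := finrank_neutralVectors_add_dualPart hf hi B hB 0
  rw [if_pos h1, zero_add, hf.dualPart_one] at hdim
  have hN : 1 ≤ N := (mem_removables.1 hi).1.1.trans (mem_removables.1 hi).1.2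
  rw [hset, Module.natCard_eq_pow_finrank (K := F), Nat.card_eq_fintype_card, ← pow_add]
  congr 1
  omega

lemma card_fiber_of_eq_add_two (hf : IsPartitionFun f (m + 1) N)
    (hi : i ∈ removables f N) {k : ℕ} (hk : f i = k + 2) (B : Matrix (Fin m) (Fin m) F)
    (hB : HasJordanType B (removeCell f i) (removeLength f N i)) :
    (Fintype.card F : ℤ) ^ dualPart f N (k + 1) *
        Nat.card {v // HasJordanType (borderMatrix B v) f N} =
      (Fintype.card F : ℤ) ^ m * ((Fintype.card F : ℤ) ^ (alphaCount f N (k + 1) + 1) - 1) := by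
  have hset : {v | HasJordanType (borderMatrix B v) f N} =
      (neutralVectors B (k + 1) : Set (Fin m → F)) \ neutralVectors B k := by
    ext v
    rw [Set.mem_ofPred_eq, hasJordanType_borderMatrix_iff_mem hf hi (k := k + 1) hk B hB]
    refine ⟨fun h => ⟨(h _).2 le_rfl, fun hv => ?_⟩, fun h j => ⟨fun hj => ?_, fun hj =>
      neutralVectors_mono B hj h.1⟩⟩
    · have := (h k).1 hv
      omega
    · by_contra hjk
      exact h.2 (neutralVectors_mono B (by omega) hj)
  have hcard : Nat.card {v // HasJordanType (borderMatrix B v) f N} +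
      Nat.card (neutralVectors B k) = Nat.card (neutralVectors B (k + 1)) := by
    have := Set.ncard_sdiff_add_ncard_of_subset
      (s := (neutralVectors B k : Set (Fin m → F))) (t := neutralVectors B (k + 1))
      (neutralVectors_mono B (Nat.le_add_right k 1))
    rwa [← hset] at this
  have hdim := finrank_neutralVectors_add_dualPart hf hi B hB k
  have hdim' : _ + dualPart f N (k + 2) = _ :=
    finrank_neutralVectors_add_dualPart hf hi B hB (k + 1)
  rw [if_neg (by omega)] at hdim
  rw [if_pos hk] at hdim'
  have hα : _ + dualPart f N (k + 2) = _ := alphaCount_add_dualPart_succ f N (k + 1)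
  rw [Module.natCard_eq_pow_finrank (K := F) (V := neutralVectors B k),
    Module.natCard_eq_pow_finrank (K := F) (V := neutralVectors B (k + 1)),
    Nat.card_eq_fintype_card (α := F)] at hcard
  replace hcard := congrArg (Nat.cast : ℕ → ℤ) hcard
  push_cast at hcard
  rw [eq_sub_of_add_eq hcard, mul_sub, mul_sub, ← pow_add, ← pow_add, ← pow_add, mul_one]
  congr 2 <;> omega

end Counting
section Recursion

/-- The exponent by which the root `0` of the counting polynomial falls short of `n.choose 2`. -/
def dualWeight (f : ℕ → ℕ) (N M : ℕ) : ℕ :=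
  N.choose 2 + ∑ j ∈ Finset.range M, dualPart f N (j + 1) * dualPart f N (j + 2)

/-- The coefficient of the term of the removable cell in row `i` in the recursion. -/
noncomputable def removalCoeff (f : ℕ → ℕ) (N i : ℕ) : ℤ[X] :=
  X ^ dualPart f N (f i + 1) * ∑ t ∈ Finset.range (alphaCount f N (f i - 1) + 1), X ^ t

variable {f : ℕ → ℕ} {m n N i M : ℕ}

lemma dualWeight_of_eq_one (hf : IsPartitionFun f n N) (hi : i ∈ removables f N)
    (h1 : f i = 1) (hM : f i ≤ M) :
    dualWeight f N M = dualWeight (removeCell f i) (removeLength f N i) M +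
      ((N - 1) + dualPart f N 2) := by
  have hN : 1 ≤ N := (mem_removables.1 hi).1.1.trans (mem_removables.1 hi).1.2
  obtain ⟨K, rfl⟩ : ∃ K, N = K + 1 := ⟨N - 1, by omega⟩
  obtain ⟨L, rfl⟩ : ∃ L, M = L + 1 := ⟨M - 1, by omega⟩
  have hlen : removeLength f (K + 1) i = K := by simp [removeLength, h1]
  have hone : dualPart (removeCell f i) K 1 + 1 = K + 1 := by
    have := hf.dualPart_removeCell hi le_rfl
    rw [if_pos h1.symm, hf.dualPart_one, hlen] at this
    exact this.symm
  have hpart : ∀ k, dualPart (removeCell f i) K (k + 2) = dualPart f (K + 1) (k + 2) := by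
    intro k
    have := hf.dualPart_removeCell hi (k := k + 2) (by omega)
    rw [if_neg (by omega), hlen] at this
    exact this.symm
  have hone' : dualPart (removeCell f i) K 1 = K := by omega
  rw [hlen, dualWeight, dualWeight, Finset.sum_range_succ', Finset.sum_range_succ',
    Nat.choose_succ_succ', Nat.choose_one_right]
  simp only [zero_add, add_assoc, Nat.reduceAdd, hone', hf.dualPart_one, hpart]
  rw [Nat.add_sub_cancel]
  ring

lemma dualWeight_of_eq_add_two (hf : IsPartitionFun f n N) (hi : i ∈ removables f N) {k : ℕ}
    (hk : f i = k + 2) (hM : f i ≤ M) :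
    dualWeight f N M = dualWeight (removeCell f i) (removeLength f N i) M +
      (dualPart f N (k + 1) + dualPart f N (k + 3)) := by
  have hlen : removeLength f N i = N := if_neg (by omega)
  have hpart : ∀ j, dualPart f N (j + 1) =
      dualPart (removeCell f i) N (j + 1) + if j = k + 1 then 1 else 0 := by
    intro j
    have := hf.dualPart_removeCell hi (Nat.le_add_left 1 j)
    rw [hlen, hk] at this
    simpa using this
  have hterm : ∀ j, dualPart f N (j + 1) * dualPart f N (j + 2) =
      dualPart (removeCell f i) N (j + 1) * dualPart (removeCell f i) N (j + 2) +
        ((if j = k then dualPart f N (k + 1) else 0) +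
          if j = k + 1 then dualPart f N (k + 3) else 0) := by
    intro j
    have h1 := hpart j
    have h2 : dualPart f N (j + 2) = dualPart (removeCell f i) N (j + 2) + _ := hpart (j + 1)
    by_cases hj : j = k
    · subst hj
      rw [h2, h1]
      simp
      ring
    · by_cases hj' : j = k + 1
      · subst hj'
        rw [h1, h2]
        simp
        ring
      · rw [h1, h2]
        simp [hj, hj']
  rw [hlen, dualWeight, dualWeight, Finset.sum_congr rfl fun j _ => hterm j,
    Finset.sum_add_distrib, Finset.sum_add_distrib, Finset.sum_ite_eq', Finset.sum_ite_eq',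
    if_pos (Finset.mem_range.2 (by omega)), if_pos (Finset.mem_range.2 (by omega)), add_assoc]

lemma weight_mul_card_fiber {F : Type*} [Field F] [Fintype F]
    (hf : IsPartitionFun f (m + 1) N) (hi : i ∈ removables f N) (hM : f i ≤ M)
    (B : Matrix (Fin m) (Fin m) F)
    (hB : HasJordanType B (removeCell f i) (removeLength f N i)) :
    ((Fintype.card F : ℤ) - 1) ^ N * (Fintype.card F : ℤ) ^ dualWeight f N M *
        Nat.card {v // HasJordanType (borderMatrix B v) f N} =
      ((Fintype.card F : ℤ) - 1) * (Fintype.card F : ℤ) ^ m *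
        (removalCoeff f N i).eval (Fintype.card F : ℤ) *
        (((Fintype.card F : ℤ) - 1) ^ removeLength f N i *
          (Fintype.card F : ℤ) ^ dualWeight (removeCell f i) (removeLength f N i) M) := by
  have hN : 1 ≤ N := (mem_removables.1 hi).1.1.trans (mem_removables.1 hi).1.2
  have hpos : 0 < f i := (Nat.zero_le _).trans_lt (mem_removables.1 hi).2
  have hcoeff : (removalCoeff f N i).eval (Fintype.card F : ℤ) =
      (Fintype.card F : ℤ) ^ dualPart f N (f i + 1) *
        ∑ t ∈ Finset.range (alphaCount f N (f i - 1) + 1), (Fintype.card F : ℤ) ^ t := by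
    simp [removalCoeff, eval_finsetSum]
  rw [hcoeff]
  obtain h1 | ⟨k, hk⟩ : f i = 1 ∨ ∃ k, f i = k + 2 := by
    obtain h | h := Nat.lt_or_ge (f i) 2
    · exact Or.inl (by omega)
    · exact Or.inr ⟨f i - 2, by omega⟩
  · rw [dualWeight_of_eq_one hf hi h1 hM]
    have hfib := congrArg (Nat.cast : ℕ → ℤ) (card_fiber_of_eq_one hf hi h1 B hB)
    push_cast at hfib
    obtain ⟨K, rfl⟩ : ∃ K, N = K + 1 := ⟨N - 1, by omega⟩
    rw [h1, Nat.sub_self, hf.alphaCount_zero, show removeLength f (K + 1) i = K by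
      simp [removeLength, h1], ← hfib, zero_add, Finset.sum_range_one, pow_add, pow_add]
    ring
  · rw [dualWeight_of_eq_add_two hf hi hk hM]
    have hfib := card_fiber_of_eq_add_two hf hi hk B hB
    rw [← geom_sum_mul] at hfib
    rw [hk, show removeLength f N i = N from if_neg (by omega), pow_add, pow_add]
    simp only [Nat.add_succ_sub_one]
    linear_combination ((Fintype.card F : ℤ) - 1) ^ N *
      (Fintype.card F : ℤ) ^ dualWeight (removeCell f i) N M *
      (Fintype.card F : ℤ) ^ dualPart f N (k + 3) * hfib

lemma jordanCount_succ_eq_sum {F : Type} [Field F] [Fintype F]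
    [Fintype {B : Matrix (Fin m) (Fin m) F // StrictUpper B}] :
    jordanCount (m + 1) f N F = ∑ B : {B : Matrix (Fin m) (Fin m) F // StrictUpper B},
      Nat.card {v // HasJordanType (borderMatrix B.1 v) f N} := by
  have hA : ∀ A : {A : Matrix (Fin (m + 1)) (Fin (m + 1)) F // StrictUpper A},
      borderMatrix (strictUpperEquiv A).1.1 (strictUpperEquiv A).2 = A.1 := fun A =>
    congrArg Subtype.val (strictUpperEquiv.symm_apply_apply A)
  let e₁ := (Equiv.subtypeSubtypeEquivSubtypeInter
    (fun A : Matrix (Fin (m + 1)) (Fin (m + 1)) F => StrictUpper A)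
    (fun A => HasJordanType A f N)).symm
  let e₂ := Equiv.subtypeEquiv (p := fun A => HasJordanType A.1 f N)
    (q := fun p => HasJordanType (borderMatrix p.1.1 p.2) f N) (strictUpperEquiv (m := m) (F := F))
    fun A => by rw [hA A]
  let e₃ := Equiv.subtypeProdEquivSigmaSubtype
    fun (B : {B : Matrix (Fin m) (Fin m) F // StrictUpper B}) v =>
      HasJordanType (borderMatrix B.1 v) f N
  rw [jordanCount, ← Nat.card_sigma]
  exact Nat.card_congr (e₁.trans (e₂.trans e₃))

lemma weight_mul_jordanCount_succ {F : Type} [Field F] [Fintype F]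
    (hf : IsPartitionFun f (m + 1) N) (hM : m + 1 ≤ M) :
    ((Fintype.card F : ℤ) - 1) ^ N * (Fintype.card F : ℤ) ^ dualWeight f N M *
        jordanCount (m + 1) f N F =
      ((Fintype.card F : ℤ) - 1) * (Fintype.card F : ℤ) ^ m *
        ∑ i ∈ removables f N, (removalCoeff f N i).eval (Fintype.card F : ℤ) *
          (((Fintype.card F : ℤ) - 1) ^ removeLength f N i *
            (Fintype.card F : ℤ) ^ dualWeight (removeCell f i) (removeLength f N i) M *
            jordanCount m (removeCell f i) (removeLength f N i) F) := by
  classical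
  have hfiber : ∀ B : {B : Matrix (Fin m) (Fin m) F // StrictUpper B},
      ((Fintype.card F : ℤ) - 1) ^ N * (Fintype.card F : ℤ) ^ dualWeight f N M *
        (Nat.card {v // HasJordanType (borderMatrix B.1 v) f N} : ℤ) =
      ∑ i ∈ removables f N, if HasJordanType B.1 (removeCell f i) (removeLength f N i) then
        ((Fintype.card F : ℤ) - 1) * (Fintype.card F : ℤ) ^ m *
          (removalCoeff f N i).eval (Fintype.card F : ℤ) *
          (((Fintype.card F : ℤ) - 1) ^ removeLength f N i *
            (Fintype.card F : ℤ) ^ dualWeight (removeCell f i) (removeLength f N i) M)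
        else 0 := by
    intro B
    by_cases h : ∃ i ∈ removables f N, HasJordanType B.1 (removeCell f i) (removeLength f N i)
    · obtain ⟨i, hi, hB⟩ := h
      have hiM : f i ≤ M := (hf.apply_le (Finset.mem_filter.1 hi).1).trans hM
      rw [weight_mul_card_fiber hf hi hiM B.1 hB, Finset.sum_eq_single_of_mem i hi, if_pos hB]
      intro j hj hji
      exact if_neg fun hBj => hji (eq_of_hasJordanType_removeCell hf hj hi B.1 hBj hB)
    · have : IsEmpty {v // HasJordanType (borderMatrix B.1 v) f N} :=
        ⟨fun v => h (exists_hasJordanType_removeCell hf B.1 v.1 v.2)⟩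
      rw [Nat.card_of_isEmpty, Nat.cast_zero, mul_zero, Finset.sum_eq_zero]
      intro i hi
      exact if_neg fun hB => h ⟨i, hi, hB⟩
  have hcount : ∀ g K, jordanCount m g K F = (Finset.univ.filter fun
      B : {B : Matrix (Fin m) (Fin m) F // StrictUpper B} => HasJordanType B.1 g K).card := by
    intro g K
    rw [jordanCount, ← Fintype.card_subtype, ← Nat.card_eq_fintype_card]
    exact Nat.card_congr (Equiv.subtypeSubtypeEquivSubtypeInter _ _).symm
  rw [jordanCount_succ_eq_sum, Nat.cast_sum, Finset.mul_sum,
    Finset.sum_congr rfl fun B _ => hfiber B, Finset.sum_comm, Finset.mul_sum]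
  refine Finset.sum_congr rfl fun i _ => ?_
  rw [← Finset.sum_filter, Finset.sum_const, ← hcount, nsmul_eq_mul]
  ring

/-- `R` is the counting polynomial of `f` stripped of its roots `0` and `1`. -/
def IsReducedCount (f : ℕ → ℕ) (n N : ℕ) (R : ℤ[X]) : Prop :=
  0 < R.eval 0 ∧ 0 < R.eval 1 ∧ ∀ M, n ≤ M → ∀ (F : Type) [Field F] [Fintype F],
    ((Fintype.card F : ℤ) - 1) ^ N * (Fintype.card F : ℤ) ^ dualWeight f N M *
        jordanCount n f N F =
      ((Fintype.card F : ℤ) - 1) ^ n * (Fintype.card F : ℤ) ^ n.choose 2 *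
        R.eval (Fintype.card F : ℤ)

lemma eval_removalCoeff_nonneg (f : ℕ → ℕ) (N i : ℕ) {x : ℤ} (hx : 0 ≤ x) :
    0 ≤ (removalCoeff f N i).eval x := by
  simp only [removalCoeff, eval_mul, eval_pow, eval_X, eval_finsetSum]
  positivity

lemma eval_one_removalCoeff_pos (f : ℕ → ℕ) (N i : ℕ) :
    0 < (removalCoeff f N i).eval 1 := by
  simp only [removalCoeff, eval_mul, eval_pow, eval_X, eval_finsetSum, one_pow, one_mul,
    Finset.sum_const, Finset.card_range, nsmul_eq_mul, mul_one]
  positivity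

lemma IsPartitionFun.exists_eval_zero_removalCoeff_pos (hf : IsPartitionFun f (m + 1) N) :
    ∃ i ∈ removables f N, 0 < (removalCoeff f N i).eval 0 := by
  have hN : 1 ≤ N := by
    by_contra hN
    have := hf.2.2
    rw [Finset.Icc_eq_empty hN, Finset.sum_empty] at this
    omega
  have hpos : 0 < f 1 := (hf.2.1 1 le_rfl).2 hN
  have hzero : dualPart f N (f 1 + 1) = 0 := by
    rw [dualPart, Finset.card_eq_zero, Finset.filter_eq_empty_iff]
    intro a ha
    have := hf.1 1 a (Finset.mem_Icc.1 ha).1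
    omega
  have hcard : 0 < dualPart f N (f 1) :=
    Finset.card_pos.2 ⟨1, Finset.mem_filter.2 ⟨Finset.mem_Icc.2 ⟨le_rfl, hN⟩, le_rfl⟩⟩
  obtain ⟨k, hk⟩ : ∃ k, f 1 = k + 1 := ⟨f 1 - 1, by omega⟩
  rw [hk] at hzero hcard
  obtain ⟨i, hi, hik⟩ := hf.exists_mem_removables (k := k) (by
    change dualPart f N (k + 1 + 1) < _
    omega)
  refine ⟨i, hi, ?_⟩
  simp [removalCoeff, hik, hzero, eval_finsetSum, Finset.sum_range_succ']

lemma IsReducedCount.sum_removables (hf : IsPartitionFun f (m + 1) N) {R' : ℕ → ℤ[X]}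
    (hR' : ∀ i ∈ removables f N,
      IsReducedCount (removeCell f i) m (removeLength f N i) (R' i)) :
    IsReducedCount f (m + 1) N (∑ i ∈ removables f N, removalCoeff f N i * R' i) := by
  obtain ⟨i, hi, hpos⟩ := hf.exists_eval_zero_removalCoeff_pos
  refine ⟨?_, ?_, fun M hM F _ _ => ?_⟩
  · simp only [eval_finsetSum, eval_mul]
    exact Finset.sum_pos' (fun j hj => mul_nonneg (eval_removalCoeff_nonneg f N j le_rfl)
      (hR' j hj).1.le) ⟨i, hi, mul_pos hpos (hR' i hi).1⟩
  · simp only [eval_finsetSum, eval_mul]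
    exact Finset.sum_pos (fun j hj => mul_pos (eval_one_removalCoeff_pos f N j) (hR' j hj).2.1)
      ⟨i, hi⟩
  · rw [weight_mul_jordanCount_succ hf hM, Finset.sum_congr rfl fun j hj =>
      congrArg _ ((hR' j hj).2.2 M (by omega) F), Finset.mul_sum]
    simp only [eval_finsetSum, eval_mul]
    rw [Finset.mul_sum]
    refine Finset.sum_congr rfl fun j _ => ?_
    rw [Nat.choose_succ_succ', Nat.choose_one_right]
    ring

lemma exists_isReducedCount (n : ℕ) : ∀ {f : ℕ → ℕ} {N : ℕ}, IsPartitionFun f n N →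
    ∃ R, IsReducedCount f n N R := by
  induction n with
  | zero =>
    intro f N hf
    have hN := hf.length_eq_zero
    subst hN
    refine ⟨1, by simp, by simp, fun M _ F _ _ => ?_⟩
    have hw : dualWeight f 0 M = 0 := by simp [dualWeight, dualPart]
    have hc : jordanCount 0 f 0 F = 1 := by
      rw [jordanCount, Nat.card_eq_one_iff_unique]
      refine ⟨inferInstance, ⟨0, fun i => i.elim0, fun k => ?_⟩⟩
      simpa using Matrix.rank_le_card_height ((0 : Matrix (Fin 0) (Fin 0) F) ^ k)
    simp [hw, hc]
  | succ m ih =>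
    intro f N hf
    choose! R' hR' using fun i (hi : i ∈ removables f N) => ih (hf.removeCell hi)
    exact ⟨_, IsReducedCount.sum_removables hf hR'⟩

lemma eq_of_X_sub_C_pow_mul_eq {A : Type*} [CommRing A] [IsDomain A] {c : A} {a b : ℕ}
    {U V : A[X]} (hU : U.eval c ≠ 0) (hV : V.eval c ≠ 0)
    (h : (X - C c) ^ a * U = (X - C c) ^ b * V) : U = V := by
  wlog hab : a ≤ b generalizing a b U V
  · exact (this hV hU h.symm (by omega)).symm
  obtain ⟨k, rfl⟩ := Nat.exists_eq_add_of_le hab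
  rw [pow_add, mul_assoc] at h
  replace h := mul_left_cancel₀ (pow_ne_zero a (X_sub_C_ne_zero c)) h
  cases k with
  | zero => simpa using h
  | succ k =>
    refine absurd ?_ hU
    rw [h]
    simp

/-- Two integer polynomials agreeing at the cardinality of every finite field are equal. -/
lemma eq_of_eval_card_eq {p q : ℤ[X]} (h : ∀ (F : Type) [Field F] [Fintype F],
    p.eval (Fintype.card F : ℤ) = q.eval (Fintype.card F : ℤ)) : p = q := by
  refine eq_of_infinite_eval_eq p q ?_
  refine (Nat.infinite_setOfPred_prime.image Nat.cast_injective.injOn).mono ?_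
  rintro _ ⟨l, hl, rfl⟩
  have : Fact l.Prime := ⟨hl⟩
  simpa [ZMod.card] using h (ZMod l)

lemma IsReducedCount.eq_of_factorization {R R₀ P : ℤ[X]} (h : IsReducedCount f n N R₀)
    (hP : ∀ (F : Type) [Field F] [Fintype F],
      (jordanCount n f N F : ℤ) = P.eval (Fintype.card F : ℤ)) {d e : ℕ}
    (hfac : P = X ^ d * (X - 1) ^ e * R) (hR0 : R.eval 0 ≠ 0) (hR1 : R.eval 1 ≠ 0) :
    R = R₀ := by
  have hpoly : (X - C 0 : ℤ[X]) ^ (dualWeight f N n + d) * ((X - C 1) ^ (N + e) * R) =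
      (X - C 0) ^ n.choose 2 * ((X - C 1) ^ n * R₀) := by
    refine eq_of_eval_card_eq fun F _ _ => ?_
    have := h.2.2 n le_rfl F
    rw [hP F, hfac] at this
    simp only [eval_mul, eval_pow, eval_sub, eval_X, eval_C, eval_one, sub_zero] at this ⊢
    linear_combination this
  refine eq_of_X_sub_C_pow_mul_eq hR1 h.2.1.ne' (eq_of_X_sub_C_pow_mul_eq ?_ ?_ hpoly)
  · simpa using hR0
  · simpa using h.1.ne'

end Recursion

theorem R_recursion (n N : ℕ) (hn : 2 ≤ n) (f : ℕ → ℕ) (hf : IsPartitionFun f n N)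
    (P : Polynomial ℤ)
    (hP : ∀ (F : Type) [Field F] [Fintype F],
      (jordanCount n f N F : ℤ) = P.eval (Fintype.card F : ℤ))
    (d e : ℕ) (R : Polynomial ℤ)
    (hfac : P = X ^ d * (X - 1) ^ e * R)
    (hR0 : R.eval 0 ≠ 0) (hR1 : R.eval 1 ≠ 0)
    (P' R' : ℕ → Polynomial ℤ) (d' e' : ℕ → ℕ)
    (hP' : ∀ i ∈ removables f N, ∀ (F : Type) [Field F] [Fintype F],
      (jordanCount (n - 1) (Function.update f i (f i - 1))
          (if f i = 1 then N - 1 else N) F : ℤ) = (P' i).eval (Fintype.card F : ℤ))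
    (hfac' : ∀ i ∈ removables f N, P' i = X ^ (d' i) * (X - 1) ^ (e' i) * R' i)
    (hR0' : ∀ i ∈ removables f N, (R' i).eval 0 ≠ 0)
    (hR1' : ∀ i ∈ removables f N, (R' i).eval 1 ≠ 0) :
    R = ∑ i ∈ removables f N,
      X ^ (dualPart f N (f i + 1)) *
        (∑ t ∈ Finset.range (alphaCount f N (f i - 1) + 1), (X : Polynomial ℤ) ^ t) *
        R' i := by
  obtain ⟨m, rfl⟩ : ∃ m, n = m + 1 := ⟨n - 1, by omega⟩
  have hred : ∀ i ∈ removables f N,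
      IsReducedCount (removeCell f i) m (removeLength f N i) (R' i) := by
    intro i hi
    obtain ⟨S, hS⟩ := exists_isReducedCount m (hf.removeCell hi)
    rwa [hS.eq_of_factorization (hP' i hi) (hfac' i hi) (hR0' i hi) (hR1' i hi)]
  exact (IsReducedCount.sum_removables hf hred).eq_of_factorization hP hfac hR0 hR1
end

section
/- For every partition λ of n ≥ 1, the constant term of the polynomial R_λ equals 1, i.e., R_λ(0) = 1. -/
open Polynomial

/-- `rankDrop A k` is the drop from `rank (A ^ k)` to `rank (A ^ (k + 1))`; for nilpotent `A` it is
the number of Jordan blocks of size larger than `k`. -/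
noncomputable def rankDrop {m : ℕ} {F : Type*} [Field F] (A : Matrix (Fin m) (Fin m) F) (k : ℕ) :
    ℕ :=
  (A ^ k).rank - (A ^ (k + 1)).rank

/-- The subspace `im A + ker A ^ j`. -/
noncomputable def rangeSupKer {m : ℕ} {F : Type*} [Field F] (A : Matrix (Fin m) (Fin m) F)
    (j : ℕ) : Submodule F (Fin m → F) :=
  LinearMap.range A.mulVecLin ⊔ LinearMap.ker (A ^ j).mulVecLin

/-- Appending the column `v` and a zero row to `A`. -/
def appendCol {m : ℕ} {F : Type*} [Zero F] (A : Matrix (Fin m) (Fin m) F) (v : Fin m → F) :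
    Matrix (Fin (m + 1)) (Fin (m + 1)) F :=
  Matrix.reindex finSumFinEquiv finSumFinEquiv
    (Matrix.fromBlocks A (Matrix.replicateCol (Fin 1) v) 0 0)

/-- The least `j` with `v ∈ im A + ker A ^ j`. -/
noncomputable def entryIndex {m : ℕ} {F : Type*} [Field F] (A : Matrix (Fin m) (Fin m) F)
    (v : Fin m → F) : ℕ :=
  sInf {j | v ∈ rangeSupKer A j}

section LinearAlgebra

variable {m : ℕ} {F : Type*} [Field F] (A : Matrix (Fin m) (Fin m) F)

lemma rank_pow_succ_le (k : ℕ) : (A ^ (k + 1)).rank ≤ (A ^ k).rank := by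
  rw [pow_succ]
  exact Matrix.rank_mul_le_left _ _

lemma rangeSupKer_mono : Monotone (rangeSupKer A) := by
  refine monotone_nat_of_le_succ fun j => sup_le_sup_left (fun x hx => ?_) _
  rw [LinearMap.mem_ker, Matrix.mulVecLin_apply] at hx ⊢
  rw [pow_succ', ← Matrix.mulVec_mulVec, hx, Matrix.mulVec_zero]

lemma finrank_rangeSupKer (j : ℕ) :
    Module.finrank F (rangeSupKer A j) + rankDrop A j = m := by
  have h1 := LinearMap.finrank_range_add_finrank_ker
    ((A ^ j).mulVecLin.domRestrict (rangeSupKer A j))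
  have h2 := LinearMap.finrank_range_add_finrank_ker (A ^ j).mulVecLin
  have h3 : LinearMap.range ((A ^ j).mulVecLin.domRestrict (rangeSupKer A j)) =
      LinearMap.range (A ^ (j + 1)).mulVecLin := by
    rw [LinearMap.range_domRestrict, rangeSupKer, Submodule.map_sup,
      LinearMap.le_ker_iff_map.1 le_rfl, sup_bot_eq, pow_succ, Matrix.mulVecLin_mul,
      LinearMap.range_comp]
  have h4 : Module.finrank F
      (LinearMap.ker ((A ^ j).mulVecLin.domRestrict (rangeSupKer A j))) =
      Module.finrank F (LinearMap.ker (A ^ j).mulVecLin) := by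
    rw [LinearMap.ker_domRestrict]
    exact (Submodule.comapSubtypeEquivOfLe le_sup_right).finrank_eq
  rw [h3, h4] at h1
  have h5 := rank_pow_succ_le A j
  rw [Module.finrank_fin_fun] at h2
  simp only [rankDrop, Matrix.rank] at h5 ⊢
  omega

lemma rankDrop_antitone : Antitone (rankDrop A) := by
  intro i j hij
  have h1 := finrank_rangeSupKer A i
  have h2 := finrank_rangeSupKer A j
  have h3 := Submodule.finrank_mono (rangeSupKer_mono A hij)
  omega

lemma mem_rangeSupKer_iff (v : Fin m → F) (k : ℕ) :
    v ∈ rangeSupKer A k ↔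
      (A ^ k).mulVec v ∈ LinearMap.range (A ^ (k + 1)).mulVecLin := by
  rw [rangeSupKer, Submodule.mem_sup]
  constructor
  · rintro ⟨_, ⟨y, rfl⟩, z, hz, rfl⟩
    refine ⟨y, ?_⟩
    rw [LinearMap.mem_ker, Matrix.mulVecLin_apply] at hz
    simp only [Matrix.mulVecLin_apply, Matrix.mulVec_add, hz, add_zero, pow_succ,
      Matrix.mulVec_mulVec]
  · rintro ⟨y, hy⟩
    refine ⟨A.mulVec y, ⟨y, rfl⟩, v - A.mulVec y, ?_, by abel⟩
    rw [LinearMap.mem_ker, Matrix.mulVecLin_apply, Matrix.mulVec_sub, ← hy,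
      Matrix.mulVecLin_apply, pow_succ, Matrix.mulVec_mulVec, sub_self]

open Classical in
lemma rank_fromBlocks_replicateCol (v : Fin m → F) :
    (Matrix.fromBlocks A (Matrix.replicateCol (Fin 1) v)
      (0 : Matrix (Fin 1) (Fin m) F) 0).rank =
      A.rank + if v ∈ LinearMap.range A.mulVecLin then 0 else 1 := by
  let L : (Fin m → F) →ₗ[F] (Fin m ⊕ Fin 1 → F) :=
    { toFun := fun x => Sum.elim x 0
      map_add' := fun x y => by ext (i | i) <;> simp
      map_smul' := fun c x => by ext (i | i) <;> simp }
  have hL : Function.Injective L := fun x y h => by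
    ext i
    exact congrFun h (Sum.inl i)
  have hr : LinearMap.range
      (Matrix.fromBlocks A (Matrix.replicateCol (Fin 1) v)
        (0 : Matrix (Fin 1) (Fin m) F) 0).mulVecLin =
      (LinearMap.range A.mulVecLin ⊔ Submodule.span F {v}).map L := by
    ext x
    simp only [LinearMap.mem_range, Matrix.mulVecLin_apply, Submodule.mem_map,
      Submodule.mem_sup, Submodule.mem_span_singleton]
    constructor
    · rintro ⟨y, rfl⟩
      refine ⟨A.mulVec (y ∘ Sum.inl) + y (Sum.inr 0) • v,
        ⟨_, ⟨_, rfl⟩, _, ⟨_, rfl⟩, rfl⟩, ?_⟩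
      rw [Matrix.fromBlocks_mulVec]
      ext (i | i)
      · simp [L, Matrix.mulVec, dotProduct, mul_comm]
      · simp [L]
    · rintro ⟨_, ⟨_, ⟨y, rfl⟩, _, ⟨c, rfl⟩, rfl⟩, rfl⟩
      refine ⟨Sum.elim y fun _ => c, ?_⟩
      rw [Matrix.fromBlocks_mulVec]
      ext (i | i)
      · simp [L, Matrix.mulVec, dotProduct, mul_comm]
      · simp [L]
  rw [Matrix.rank, hr, ← (Submodule.equivMapOfInjective L hL _).finrank_eq]
  split_ifs with h
  · rw [sup_eq_left.2 ((Submodule.span_singleton_le_iff_mem _ _).2 h)]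
    rfl
  · exact Submodule.finrank_sup_span_singleton h

lemma appendCol_pow_succ (v : Fin m → F) (k : ℕ) :
    appendCol A v ^ (k + 1) = Matrix.reindex finSumFinEquiv finSumFinEquiv
      (Matrix.fromBlocks (A ^ (k + 1)) (Matrix.replicateCol (Fin 1) ((A ^ k).mulVec v)) 0 0) := by
  induction k with
  | zero => simp [appendCol]
  | succ k ih =>
    rw [pow_succ', ih, appendCol, Matrix.reindex_apply, Matrix.reindex_apply,
      Matrix.submatrix_mul_equiv, Matrix.fromBlocks_multiply, Matrix.reindex_apply]
    simp only [Matrix.mul_zero, Matrix.zero_mul, add_zero, ← pow_succ',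
      ← Matrix.replicateCol_mulVec, Matrix.mulVec_mulVec, Matrix.zero_mulVec,
      Matrix.replicateCol_zero]

lemma rank_appendCol_pow_succ (v : Fin m → F) (k : ℕ) [Decidable (v ∈ rangeSupKer A k)] :
    (appendCol A v ^ (k + 1)).rank =
      (A ^ (k + 1)).rank + if v ∈ rangeSupKer A k then 0 else 1 := by
  classical
  rw [appendCol_pow_succ, Matrix.rank_reindex, rank_fromBlocks_replicateCol]
  simp only [mem_rangeSupKer_iff]

variable {A}

lemma StrictUpper.pow_apply_eq_zero (hA : StrictUpper A) (k : ℕ) (i j : Fin m)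
    (h : (j : ℕ) < i + k) : (A ^ k) i j = 0 := by
  induction k generalizing i with
  | zero => simp [show i ≠ j by rintro rfl; omega]
  | succ k ih =>
    rw [pow_succ', Matrix.mul_apply]
    refine Finset.sum_eq_zero fun l _ => ?_
    by_cases hl : (l : ℕ) ≤ i
    · rw [hA i l hl, zero_mul]
    · rw [ih l (by omega), mul_zero]

lemma StrictUpper.pow_eq_zero (hA : StrictUpper A) : A ^ m = 0 := by
  ext i j
  exact hA.pow_apply_eq_zero m i j (by omega)

lemma StrictUpper.mem_rangeSupKer_iff_entryIndex_le (hA : StrictUpper A) (v : Fin m → F) (k : ℕ) :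
    v ∈ rangeSupKer A k ↔ entryIndex A v ≤ k := by
  have hne : {j | v ∈ rangeSupKer A j}.Nonempty := by
    refine ⟨m, ?_⟩
    simp [rangeSupKer, hA.pow_eq_zero]
  exact ⟨fun h => Nat.sInf_le h, fun h => rangeSupKer_mono A h (Nat.sInf_mem hne)⟩

lemma StrictUpper.rankDrop_appendCol (hA : StrictUpper A) (v : Fin m → F) :
    rankDrop (appendCol A v) = rankDrop A + Pi.single (entryIndex A v) 1 := by
  classical
  ext k
  have h1 := rank_appendCol_pow_succ A v k
  have h2 := rank_pow_succ_le A k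
  rw [hA.mem_rangeSupKer_iff_entryIndex_le] at h1
  simp only [rankDrop, Pi.add_apply, Pi.single_apply, h1]
  rcases k with - | k
  · simp only [pow_zero, Matrix.rank_one, Fintype.card_fin] at h2 ⊢
    split_ifs <;> omega
  · rw [rank_appendCol_pow_succ A v k, hA.mem_rangeSupKer_iff_entryIndex_le]
    split_ifs <;> omega

end LinearAlgebra

section Counting

variable {m : ℕ} {F : Type} [Field F] [Fintype F]

/-- The number of strictly upper triangular `m × m` matrices over `F` with rank drops `c`. -/
noncomputable def rankDropCount (m : ℕ) (c : ℕ → ℕ) (F : Type) [Field F] [Fintype F] : ℕ :=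
  Nat.card {A : Matrix (Fin m) (Fin m) F // StrictUpper A ∧ rankDrop A = c}

/-- The number of columns entering a matrix of size `m` at index `j` to produce the rank drops
`c`. -/
def entryWeight (m : ℕ) (c : ℕ → ℕ) (q : ℤ) : ℕ → ℤ
  | 0 => q ^ (m + 1 - c 0)
  | j + 1 => q ^ (m + 1 - c (j + 1)) - q ^ (m - c j)

open Classical in
lemma card_filter_mem_rangeSupKer (A : Matrix (Fin m) (Fin m) F) (j : ℕ) :
    (Finset.univ.filter fun v => v ∈ rangeSupKer A j).card =
      Fintype.card F ^ (m - rankDrop A j) := by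
  have h := finrank_rangeSupKer A j
  rw [← Fintype.card_subtype]
  have h2 : Fintype.card {v // v ∈ rangeSupKer A j} =
      Fintype.card F ^ Module.finrank F (rangeSupKer A j) := Module.card_eq_pow_finrank
  rw [h2]
  congr 1
  omega

lemma StrictUpper.card_filter_entryIndex_eq {A : Matrix (Fin m) (Fin m) F} (hA : StrictUpper A)
    (c : ℕ → ℕ) (j : ℕ) (h : rankDrop A + Pi.single j 1 = c) :
    ((Finset.univ.filter fun v => entryIndex A v = j).card : ℤ) =
      entryWeight m c (Fintype.card F) j := by
  classical
  subst h
  rcases j with - | j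
  · have h : (Finset.univ.filter fun v => entryIndex A v = 0) =
        Finset.univ.filter fun v => v ∈ rangeSupKer A 0 := by
      ext v
      simp [hA.mem_rangeSupKer_iff_entryIndex_le]
    rw [h, card_filter_mem_rangeSupKer]
    simp [entryWeight]
  · have h : (Finset.univ.filter fun v => entryIndex A v = j + 1) =
        (Finset.univ.filter fun v => v ∈ rangeSupKer A (j + 1)) \
          Finset.univ.filter fun v => v ∈ rangeSupKer A j := by
      ext v
      simp only [hA.mem_rangeSupKer_iff_entryIndex_le, Finset.mem_filter, Finset.mem_univ,
        true_and, Finset.mem_sdiff]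
      omega
    have hsub : (Finset.univ.filter fun v => v ∈ rangeSupKer A j) ⊆
        Finset.univ.filter fun v => v ∈ rangeSupKer A (j + 1) := by
      intro v
      simp only [Finset.mem_filter, Finset.mem_univ, true_and]
      exact fun hv => rangeSupKer_mono A j.le_succ hv
    rw [h, Finset.card_sdiff_of_subset hsub, Nat.cast_sub (Finset.card_le_card hsub),
      card_filter_mem_rangeSupKer, card_filter_mem_rangeSupKer]
    simp [entryWeight]

/-- A strictly upper triangular matrix is a smaller one with a column appended. -/
def strictUpperSuccEquiv (m : ℕ) (F : Type) [Field F] :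
    {B : Matrix (Fin (m + 1)) (Fin (m + 1)) F // StrictUpper B} ≃
      {A : Matrix (Fin m) (Fin m) F // StrictUpper A} × (Fin m → F) where
  toFun B := (⟨fun i j => B.1 i.castSucc j.castSucc, fun i j h => B.2 _ _ h⟩,
    fun i => B.1 i.castSucc (Fin.last m))
  invFun p := ⟨appendCol p.1.1 p.2, fun i j h => by
    induction i using Fin.addCases with
    | left i =>
      induction j using Fin.addCases with
      | left j => simpa [appendCol] using p.1.2 i j h
      | right j => simp at h; omega
    | right i =>
      induction j using Fin.addCases <;> simp [appendCol]⟩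
  left_inv B := by
    ext i j
    induction i using Fin.addCases with
    | left i =>
      induction j using Fin.addCases with
      | left j => simp [appendCol]; rfl
      | right j => simp [appendCol]; rw [Subsingleton.elim j 0]; rfl
    | right i =>
      have h0 : ∀ j : Fin (m + 1), B.1 (Fin.natAdd m i) j = 0 := fun j =>
        B.2 _ _ (by simp; omega)
      induction j using Fin.addCases <;> simp [appendCol, h0] <;> rfl
  right_inv p := by
    obtain ⟨⟨A, hA⟩, v⟩ := p
    ext i j
    · exact congrArg₂ (Matrix.fromBlocks A (Matrix.replicateCol (Fin 1) v) 0 0)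
        (finSumFinEquiv_symm_apply_castAdd (n := 1) i) (finSumFinEquiv_symm_apply_castAdd (n := 1) j)
    · exact congrArg₂ (Matrix.fromBlocks A (Matrix.replicateCol (Fin 1) v) 0 0)
        (finSumFinEquiv_symm_apply_castAdd (n := 1) i) (finSumFinEquiv_symm_apply_natAdd (m := m) 0)

open Classical in
lemma rankDropCount_eq_card_filter (c : ℕ → ℕ) :
    rankDropCount m c F = (Finset.univ.filter fun A :
      {A : Matrix (Fin m) (Fin m) F // StrictUpper A} => rankDrop A.1 = c).card := by
  rw [rankDropCount, ← Fintype.card_subtype, ← Nat.card_eq_fintype_card]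
  exact Nat.card_congr (Equiv.subtypeSubtypeEquivSubtypeInter _ _).symm

lemma StrictUpper.card_filter_rankDrop_appendCol {A : Matrix (Fin m) (Fin m) F}
    (hA : StrictUpper A) (c : ℕ → ℕ) (K : ℕ) (hK : ∀ k, K ≤ k → c k = 0) :
    letI := Classical.decEq (ℕ → ℕ)
    ((Finset.univ.filter fun v => rankDrop (appendCol A v) = c).card : ℤ) =
      ∑ j ∈ (Finset.range K).filter fun j => c (j + 1) < c j,
        if rankDrop A = c - Pi.single j 1 then entryWeight m c (Fintype.card F) j else 0 := by
  classical
  rw [Finset.card_eq_sum_card_fiberwise (f := entryIndex A)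
    (t := (Finset.range K).filter fun j => c (j + 1) < c j)]
  · push_cast
    refine Finset.sum_congr rfl fun j hj => ?_
    simp only [Finset.mem_filter, Finset.mem_range] at hj
    have hiff : rankDrop A = c - Pi.single j 1 ↔ rankDrop A + Pi.single j 1 = c := by
      constructor
      · intro h
        ext k
        rw [h]
        by_cases hk : k = j
        · subst hk; simp; omega
        · simp [hk]
      · rintro rfl
        simp
    rw [Finset.filter_filter]
    split_ifs with h
    · rw [hiff] at h
      rw [← hA.card_filter_entryIndex_eq c j h]
      congr 2
      ext v
      simp only [hA.rankDrop_appendCol, Finset.mem_filter, Finset.mem_univ, true_and]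
      constructor
      · exact fun h => h.2
      · rintro rfl
        exact ⟨h, rfl⟩
    · rw [hiff] at h
      rw [Nat.cast_eq_zero, Finset.card_eq_zero, Finset.filter_eq_empty_iff]
      rintro v - ⟨hv, rfl⟩
      exact h (hA.rankDrop_appendCol v ▸ hv)
  · intro v hv
    simp only [Finset.coe_filter, Finset.mem_univ, true_and, Set.mem_ofPred_eq,
      hA.rankDrop_appendCol, Finset.mem_range] at hv ⊢
    have h1 := rankDrop_antitone A (Nat.le_succ (entryIndex A v))
    have h2 : c (entryIndex A v) = rankDrop A (entryIndex A v) + 1 := by simp [← hv]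
    have h3 : c (entryIndex A v + 1) = rankDrop A (entryIndex A v + 1) := by simp [← hv]
    refine ⟨?_, by simp only [Nat.succ_eq_add_one] at h1; omega⟩
    by_contra! h
    have := hK _ h
    omega

/-- Removing the last column gives a recursion over the removable cells. -/
lemma rankDropCount_succ (c : ℕ → ℕ) (K : ℕ) (hK : ∀ k, K ≤ k → c k = 0) :
    (rankDropCount (m + 1) c F : ℤ) =
      ∑ j ∈ (Finset.range K).filter fun j => c (j + 1) < c j,
        entryWeight m c (Fintype.card F) j * rankDropCount m (c - Pi.single j 1) F := by
  classical
  have h1 : rankDropCount (m + 1) c F =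
      ∑ A : {A : Matrix (Fin m) (Fin m) F // StrictUpper A},
        (Finset.univ.filter fun v => rankDrop (appendCol A.1 v) = c).card := by
    rw [rankDropCount_eq_card_filter, Finset.card_filter,
      ← (strictUpperSuccEquiv m F).symm.sum_comp, Fintype.sum_prod_type]
    simp only [Finset.card_filter]
    rfl
  rw [h1]
  push_cast
  have h2 : ∀ A : {A : Matrix (Fin m) (Fin m) F // StrictUpper A}, _ := fun A =>
    A.2.card_filter_rankDrop_appendCol c K hK
  convert Finset.sum_congr rfl fun A _ => h2 A using 1
  rw [Finset.sum_comm]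
  refine Finset.sum_congr rfl fun j _ => ?_
  rw [rankDropCount_eq_card_filter, ← Finset.sum_filter, Finset.sum_const, nsmul_eq_mul, mul_comm]

end Counting

section ConstantTerm

/-- The quadratic statistic governing the power of `q` dividing the number of matrices. -/
def dropEnergy (K : ℕ) (c : ℕ → ℕ) : ℕ :=
  (c 0).choose 2 + ∑ i ∈ Finset.range K, c (i + 1) * c i

/-- The entry preceding index `j`, with the convention that index `0` precedes itself. -/
def prevEntry (c : ℕ → ℕ) : ℕ → ℕ
  | 0 => c 0
  | j + 1 => c j

lemma dropEnergy_add_single {K j : ℕ} (hj : j < K) (c : ℕ → ℕ) :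
    dropEnergy K (c + Pi.single j 1) = dropEnergy K c + c (j + 1) + prevEntry c j := by
  rcases j with - | j
  · have h : ∀ i ∈ Finset.range K, (c + Pi.single 0 1 : ℕ → ℕ) (i + 1) * (c + Pi.single 0 1 : ℕ → ℕ) i =
        c (i + 1) * c i + if i = 0 then c (i + 1) else 0 := by
      intro i _
      rcases i with - | i <;> simp [mul_add]
    rw [dropEnergy, Finset.sum_congr rfl h, Finset.sum_add_distrib, Finset.sum_ite_eq',
      if_pos (Finset.mem_range.2 hj), dropEnergy, prevEntry]
    simp [Nat.choose_succ_succ' _ 1]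
    ring
  · have h : ∀ i ∈ Finset.range K,
        (c + Pi.single (j + 1) 1 : ℕ → ℕ) (i + 1) * (c + Pi.single (j + 1) 1 : ℕ → ℕ) i =
        c (i + 1) * c i + (if i = j + 1 then c (i + 1) else 0) + if i = j then c i else 0 := by
      intro i _
      simp only [Pi.add_apply, Pi.single_apply, add_left_inj]
      split_ifs <;> first | omega | ring
    rw [dropEnergy, Finset.sum_congr rfl h, Finset.sum_add_distrib, Finset.sum_add_distrib,
      Finset.sum_ite_eq', Finset.sum_ite_eq', if_pos (Finset.mem_range.2 hj),
      if_pos (Finset.mem_range.2 (by omega)), dropEnergy, prevEntry]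
    simp
    ring

lemma exists_entryWeight_eq {m : ℕ} (c : ℕ → ℕ) (j : ℕ) (hc : Antitone (c + Pi.single j 1))
    (hm : prevEntry c j ≤ m) :
    ∃ G : ℤ[X], G.eval 0 = 1 ∧ 0 < G.eval 1 ∧ ∀ q : ℤ,
      entryWeight m (c + Pi.single j 1) q j =
        q ^ (m - prevEntry c j) * (q - 1) ^ (if j = 0 then 0 else 1) * G.eval q := by
  rcases j with - | j
  · exact ⟨1, by simp, by simp, fun q => by simp [entryWeight, prevEntry]⟩
  · have h := hc (Nat.le_succ j)
    simp only [prevEntry] at hm ⊢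
    simp only [Nat.succ_eq_add_one, Pi.add_apply, Pi.single_eq_same,
      Pi.single_apply, Nat.left_eq_add, one_ne_zero, if_false, add_zero] at h
    refine ⟨∑ i ∈ Finset.range (c j - c (j + 1)), X ^ i, ?_, ?_, fun q => ?_⟩
    · obtain ⟨k, hk⟩ : ∃ k, c j - c (j + 1) = k + 1 := ⟨c j - c (j + 1) - 1, by omega⟩
      rw [hk, Finset.sum_range_succ']
      simp [eval_finsetSum]
    · simp [eval_finsetSum]
      omega
    · have h2 : m - c (j + 1) = m - c j + (c j - c (j + 1)) := by omega
      have h3 := mul_geom_sum q (c j - c (j + 1))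
      simp only [entryWeight, Pi.add_apply, Pi.single_eq_same, Pi.single_apply,
        Nat.left_eq_add, one_ne_zero, if_false, add_zero, Nat.add_sub_add_right, h2, pow_add,
        eval_finsetSum, eval_pow, eval_X, Nat.add_eq_zero_iff, and_false, pow_one, mul_assoc, h3]
      ring

lemma antitone_of_antitone_add_single {c : ℕ → ℕ} {j : ℕ} (hc : Antitone (c + Pi.single j 1))
    (hj : c (j + 1) ≤ c j) : Antitone c := by
  refine antitone_nat_of_succ_le fun i => ?_
  have h := hc (Nat.le_succ i)
  simp only [Nat.succ_eq_add_one, Pi.add_apply, Pi.single_apply] at h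
  by_cases hi : i = j
  · exact hi ▸ hj
  · rw [if_neg hi] at h
    omega

/-- The number of strictly upper triangular matrices with given rank drops, up to powers of `q` and
`q - 1`, is a polynomial with constant term `1`. -/
lemma exists_rankDropCount_eq (K m : ℕ) (c : ℕ → ℕ) (hc : Antitone c)
    (hK : ∀ k, K ≤ k → c k = 0) (hm : ∑ i ∈ Finset.range K, c i = m) :
    ∃ (D E : ℕ) (S : ℤ[X]), D + dropEnergy K c = m.choose 2 ∧ E + c 0 = m ∧
      S.eval 0 = 1 ∧ 0 < S.eval 1 ∧ ∀ (F : Type) [Field F] [Fintype F],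
        (rankDropCount m c F : ℤ) =
          (Fintype.card F : ℤ) ^ D * ((Fintype.card F : ℤ) - 1) ^ E * S.eval (Fintype.card F : ℤ) := by
  induction m generalizing c with
  | zero =>
    have h0 : c = 0 := by
      ext k
      by_cases hk : k < K
      · exact Finset.sum_eq_zero_iff.1 hm k (Finset.mem_range.2 hk)
      · exact hK k (by omega)
    subst h0
    refine ⟨0, 0, 1, by simp [dropEnergy], by simp, by simp, by simp, fun F _ _ => ?_⟩
    have : Unique {A : Matrix (Fin 0) (Fin 0) F // StrictUpper A ∧ rankDrop A = 0} :=
      { default := ⟨0, fun i => i.elim0, by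
          ext k
          exact Nat.sub_eq_zero_of_le ((Matrix.rank_le_width _).trans (Nat.zero_le _))⟩
        uniq := fun A => Subsingleton.elim _ _ }
    simp [rankDropCount]
  | succ m ih =>
    set J := (Finset.range K).filter fun j => c (j + 1) < c j with hJ
    have hex : ∃ k, c k = 0 := ⟨K, hK K le_rfl⟩
    have hpos : c 0 ≠ 0 := fun h => by
      have : ∑ i ∈ Finset.range K, c i = 0 :=
        Finset.sum_eq_zero fun i _ => Nat.le_zero.1 (h ▸ hc (Nat.zero_le i))
      omega
    obtain ⟨l, hl⟩ : ∃ l, Nat.find hex = l + 1 :=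
      Nat.exists_eq_succ_of_ne_zero fun h => hpos ((Nat.find_eq_zero hex).1 h)
    have hl0 : c (l + 1) = 0 := hl ▸ Nat.find_spec hex
    have hl1 : c l ≠ 0 := Nat.find_min hex (by omega)
    have hlJ : l ∈ J := by
      simp only [hJ, Finset.mem_filter, Finset.mem_range]
      refine ⟨?_, by omega⟩
      by_contra! h
      exact hl1 (hK l h)
    have key : ∀ j ∈ J, ∃ (D E : ℕ) (S : ℤ[X]),
        D + dropEnergy K c = (m + 1).choose 2 + c (j + 1) ∧ E + c 0 = m + 1 ∧
        S.eval 0 = 1 ∧ 0 < S.eval 1 ∧ ∀ (F : Type) [Field F] [Fintype F],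
          entryWeight m c (Fintype.card F) j * (rankDropCount m (c - Pi.single j 1) F : ℤ) =
            (Fintype.card F : ℤ) ^ D * ((Fintype.card F : ℤ) - 1) ^ E *
              S.eval (Fintype.card F : ℤ) := by
      intro j hj
      simp only [hJ, Finset.mem_filter, Finset.mem_range] at hj
      obtain ⟨c', rfl⟩ : ∃ c' : ℕ → ℕ, c = c' + Pi.single j 1 := by
        refine ⟨c - Pi.single j 1, ?_⟩
        ext k
        by_cases hk : k = j
        · subst hk; simp; omega
        · simp [hk]
      have hjj : c' (j + 1) ≤ c' j := by
        have h := hj.2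
        simp only [Pi.add_apply, Pi.single_apply, Nat.add_eq_left, one_ne_zero, if_false,
          if_true] at h
        omega
      have hc' := antitone_of_antitone_add_single hc hjj
      have hK' : ∀ k, K ≤ k → c' k = 0 := fun k hk => by
        have := hK k hk
        simp only [Pi.add_apply] at this
        omega
      have hm' : ∑ i ∈ Finset.range K, c' i = m := by
        simp only [Pi.add_apply, Finset.sum_add_distrib, Finset.sum_pi_single',
          Finset.mem_range, hj.1, if_true] at hm
        omega
      have hle : ∀ k, k < K → c' k ≤ m := fun k hk => hm' ▸
        Finset.single_le_sum (fun _ _ => Nat.zero_le _) (Finset.mem_range.2 hk)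
      have hprev : prevEntry c' j ≤ m := by
        rcases j with - | j
        · exact hle 0 hj.1
        · exact hle j (by omega)
      obtain ⟨D, E, S, hD, hE, hS0, hS1, hS⟩ := ih c' hc' hK' hm'
      obtain ⟨G, hG0, hG1, hG⟩ := exists_entryWeight_eq c' j hc hprev
      refine ⟨D + (m - prevEntry c' j), E + if j = 0 then 0 else 1, G * S, ?_, ?_, ?_, ?_, ?_⟩
      · rw [dropEnergy_add_single hj.1, Nat.choose_succ_succ' m 1, Nat.choose_one_right]
        simp
        omega
      · rcases j with - | j <;> simp <;> omega
      · rw [eval_mul, hS0, hG0, one_mul]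
      · rw [eval_mul]
        exact mul_pos hG1 hS1
      · intro F _ _
        rw [add_tsub_cancel_right, hS, hG, eval_mul]
        ring
    choose! D E S hD hE hS0 hS1 hS using key
    refine ⟨D l, E l, ∑ j ∈ J, X ^ c (j + 1) * S j, ?_, hE l hlJ, ?_, ?_, fun F _ _ => ?_⟩
    · rw [hD l hlJ, hl0, add_zero]
    · rw [eval_finsetSum, Finset.sum_eq_single_of_mem l hlJ]
      · simp [hl0, hS0 l hlJ]
      · intro j hj hjl
        have hne : c (j + 1) ≠ 0 := by
          intro h
          simp only [hJ, Finset.mem_filter] at hj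
          rcases lt_or_gt_of_ne hjl with h' | h'
          · have := hc (show j + 1 ≤ l by omega)
            omega
          · have := hc (show l + 1 ≤ j by omega)
            omega
        simp [hne]
    · rw [eval_finsetSum]
      refine Finset.sum_pos (fun j hj => ?_) ⟨l, hlJ⟩
      simpa using hS1 j hj
    · rw [rankDropCount_succ c K hK, eval_finsetSum, Finset.mul_sum]
      refine Finset.sum_congr rfl fun j hj => ?_
      have h1 : D j = D l + c (j + 1) := by
        have := hD j hj
        have := hD l hlJ
        omega
      have h2 : E j = E l := by
        have := hE j hj
        have := hE l hlJ
        omega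
      rw [hS j hj, h1, h2, eval_mul, eval_pow, eval_X]
      ring

lemma eq_of_X_pow_mul_X_sub_one_pow_mul_eq {d e D E : ℕ} {R S : ℤ[X]}
    (h : X ^ d * (X - 1) ^ e * R = X ^ D * (X - 1) ^ E * S)
    (hR0 : R.eval 0 ≠ 0) (hR1 : R.eval 1 ≠ 0) (hS0 : S.eval 0 ≠ 0) (hS1 : S.eval 1 ≠ 0) :
    R = S := by
  have hX : (X : ℤ[X]) ≠ 0 := X_ne_zero
  have hX1 : (X - 1 : ℤ[X]) ≠ 0 := X_sub_C_ne_zero 1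
  have hd : d = D := by
    rcases lt_trichotomy d D with hlt | heq | hlt
    · obtain ⟨k, rfl⟩ := Nat.exists_eq_add_of_lt hlt
      have := mul_left_cancel₀ (pow_ne_zero d hX)
        (show X ^ d * ((X - 1) ^ e * R) = X ^ d * (X * (X ^ k * (X - 1) ^ E * S)) by
          rw [← mul_assoc, h]; ring)
      have := congrArg (eval 0) this
      simp [hR0] at this
    · exact heq
    · obtain ⟨k, rfl⟩ := Nat.exists_eq_add_of_lt hlt
      have := mul_left_cancel₀ (pow_ne_zero D hX)
        (show X ^ D * ((X - 1) ^ E * S) = X ^ D * (X * (X ^ k * (X - 1) ^ e * R)) by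
          rw [← mul_assoc, ← h]; ring)
      have := congrArg (eval 0) this
      simp [hS0] at this
  subst hd
  rw [mul_assoc, mul_assoc] at h
  replace h := mul_left_cancel₀ (pow_ne_zero d hX) h
  have he : e = E := by
    rcases lt_trichotomy e E with hlt | heq | hlt
    · obtain ⟨k, rfl⟩ := Nat.exists_eq_add_of_lt hlt
      have := mul_left_cancel₀ (pow_ne_zero e hX1)
        (show (X - 1) ^ e * R = (X - 1) ^ e * ((X - 1) * ((X - 1) ^ k * S)) by
          rw [h]; ring)
      have := congrArg (eval 1) this
      simp [hR1] at this
    · exact heq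
    · obtain ⟨k, rfl⟩ := Nat.exists_eq_add_of_lt hlt
      have := mul_left_cancel₀ (pow_ne_zero E hX1)
        (show (X - 1) ^ E * S = (X - 1) ^ E * ((X - 1) * ((X - 1) ^ k * R)) by
          rw [← h]; ring)
      have := congrArg (eval 1) this
      simp [hS1] at this
  subst he
  exact mul_left_cancel₀ (pow_ne_zero e hX1) h

lemma IsPartitionFun.le_of_mem {n N : ℕ} {f : ℕ → ℕ} (hf : IsPartitionFun f n N) {i : ℕ}
    (hi : i ∈ Finset.Icc 1 N) : f i ≤ n :=
  hf.2.2 ▸ Finset.single_le_sum (fun _ _ => Nat.zero_le _) hi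

lemma sum_tsub_eq_sum_tsub_succ_add_dualPart (f : ℕ → ℕ) (N k : ℕ) :
    ∑ i ∈ Finset.Icc 1 N, (f i - k) =
      ∑ i ∈ Finset.Icc 1 N, (f i - (k + 1)) + dualPart f N (k + 1) := by
  rw [dualPart, Finset.card_filter, ← Finset.sum_add_distrib]
  refine Finset.sum_congr rfl fun i _ => ?_
  split_ifs <;> omega

lemma hasJordanType_iff_rankDrop {n N : ℕ} {f : ℕ → ℕ} (hf : IsPartitionFun f n N)
    {F : Type*} [Field F] (A : Matrix (Fin n) (Fin n) F) :
    HasJordanType A f N ↔ rankDrop A = fun k => dualPart f N (k + 1) := by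
  constructor
  · intro h
    ext k
    rw [rankDrop, h k, h (k + 1), sum_tsub_eq_sum_tsub_succ_add_dualPart, add_tsub_cancel_left]
  · intro h k
    induction k with
    | zero => simpa using hf.2.2.symm
    | succ k ih =>
      have h1 := congrFun h k
      have h2 := rank_pow_succ_le A k
      have h3 := sum_tsub_eq_sum_tsub_succ_add_dualPart f N k
      simp only [rankDrop] at h1
      omega

end ConstantTerm

theorem R_constant_term (n N : ℕ) (hn : 1 ≤ n) (f : ℕ → ℕ) (hf : IsPartitionFun f n N)
    (P : Polynomial ℤ)
    (hP : ∀ (F : Type) [Field F] [Fintype F],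
      (jordanCount n f N F : ℤ) = P.eval (Fintype.card F : ℤ))
    (d e : ℕ) (R : Polynomial ℤ)
    (hfac : P = X ^ d * (X - 1) ^ e * R)
    (hR0 : R.eval 0 ≠ 0) (hR1 : R.eval 1 ≠ 0) :
    R.eval 0 = 1 := by
  set c : ℕ → ℕ := fun k => dualPart f N (k + 1) with hc
  have hanti : Antitone c := fun i j hij => Finset.card_le_card fun x hx => by
    simp only [Finset.mem_filter] at hx ⊢
    exact ⟨hx.1, by omega⟩
  have hzero : ∀ k, n ≤ k → c k = 0 := fun k hk => by
    simp only [hc, dualPart, Finset.card_eq_zero, Finset.filter_eq_empty_iff]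
    intro i hi
    have := hf.le_of_mem hi
    omega
  have hsum : ∑ i ∈ Finset.range n, c i = n := by
    have h : ∀ k, ∑ i ∈ Finset.Icc 1 N, (f i - k) + ∑ i ∈ Finset.range k, c i = n := by
      intro k
      induction k with
      | zero => simpa using hf.2.2
      | succ k ih =>
        have := sum_tsub_eq_sum_tsub_succ_add_dualPart f N k
        rw [Finset.sum_range_succ]
        simp only [hc] at ih ⊢
        omega
    have h0 : ∑ i ∈ Finset.Icc 1 N, (f i - n) = 0 :=
      Finset.sum_eq_zero fun i hi => Nat.sub_eq_zero_of_le (hf.le_of_mem hi)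
    have := h n
    omega
  obtain ⟨D, E, S, -, -, hS0, hS1, hS⟩ := exists_rankDropCount_eq n n c hanti hzero hsum
  have hPS : P = X ^ D * (X - 1) ^ E * S := by
    refine eq_of_infinite_eval_eq _ _ (Set.Infinite.mono ?_
      (Nat.infinite_setOfPred_prime.image (f := ((↑) : ℕ → ℤ)) Nat.cast_injective.injOn))
    rintro _ ⟨p, hp, rfl⟩
    have : Fact p.Prime := ⟨hp⟩
    have h1 := hP (ZMod p)
    have h2 := hS (ZMod p)
    have h3 : jordanCount n f N (ZMod p) = rankDropCount n c (ZMod p) := by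
      simp only [jordanCount, rankDropCount, hasJordanType_iff_rankDrop hf, hc]
    rw [h3, h2, ZMod.card] at h1
    simp [← h1]
  rw [eq_of_X_pow_mul_X_sub_one_pow_mul_eq (hfac.symm.trans hPS) hR0 hR1 (by simp [hS0]) hS1.ne', hS0]
end
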